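/- arXiv:1611.06019 — 2 statements merged into one kernel-verified Lean document; each statement's English description precedes it below -/
import Mathlib

section
/- Assume J¹_A ≥ |J²_A| for all A ⊆ Λ and J²_A = 0 whenever |A| is odd. Then for every B ⊆ Λ the classical XY Gibbs expectation ⟨σ¹_B⟩ is a nondecreasing function of the inverse temperature β on (0,∞): if 0 < β ≤ β′ then ⟨σ¹_B⟩ at inverse temperature β is ≤ ⟨σ¹_B⟩ at inverse temperature β′. -/
open MeasureTheory Real

/-- The box `[0, 2π]^Λ` of classical XY configurations. -/
def xyBox (Λ : Type*) [Fintype Λ] : Set (Λ → ℝ) :=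
  Set.univ.pi fun _ : Λ => Set.Icc (0 : ℝ) (2 * π)

/-- Classical XY Hamiltonian with many-body couplings `J1, J2` indexed by subsets of `Λ`:
`H(φ) = −Σ_{A⊆Λ} (J¹_A ∏_{x∈A} cos φ_x + J²_A ∏_{x∈A} sin φ_x)`. -/
noncomputable def xyHam {Λ : Type*} [Fintype Λ] (J1 J2 : Finset Λ → ℝ) (φ : Λ → ℝ) : ℝ :=
  - ∑ A : Finset Λ, (J1 A * ∏ x ∈ A, Real.cos (φ x) + J2 A * ∏ x ∈ A, Real.sin (φ x))

/-- Gibbs expectation of a functional `f` for the classical XY model at inverse temperature `β`: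
`⟨f⟩ = Z⁻¹ ∫_{[0,2π]^Λ} f(φ) e^{−βH(φ)} ∏ dφ_x/(2π)` (the normalisations `1/(2π)` cancel in
the ratio). -/
noncomputable def xyGibbs {Λ : Type*} [Fintype Λ] (J1 J2 : Finset Λ → ℝ) (β : ℝ)
    (f : (Λ → ℝ) → ℝ) : ℝ :=
  (∫ φ in xyBox Λ, f φ * Real.exp (-β * xyHam J1 J2 φ)) /
  (∫ φ in xyBox Λ, Real.exp (-β * xyHam J1 J2 φ))

/-- `σ¹_X = ∏_{x∈X} cos φ_x`. -/
noncomputable def sigma1 {Λ : Type*} (X : Finset Λ) (φ : Λ → ℝ) : ℝ :=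
  ∏ x ∈ X, Real.cos (φ x)

/-- `σ²_X = ∏_{x∈X} sin φ_x`. -/
noncomputable def sigma2 {Λ : Type*} (X : Finset Λ) (φ : Λ → ℝ) : ℝ :=
  ∏ x ∈ X, Real.sin (φ x)

/-- The map `k ↦ k ⊗ k`, sending a continuous function to the product of two copies of it. -/
def tensorSquare (X : Type*) [TopologicalSpace X] : C(X, ℝ) →* C(X × X, ℝ) where
  toFun k := k.comp .fst * k.comp .snd
  map_one' := by ext; simp
  map_mul' k l := by ext; simp; ring

/-- The closed subsemiring of `C(X × X, ℝ)` generated by the functions `k ⊗ k`. -/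
def tensorSquareCone (X : Type*) [TopologicalSpace X] [CompactSpace X] : Subsemiring C(X × X, ℝ) :=
  (MonoidHom.mrange (tensorSquare X)).subsemiringClosure.topologicalClosure

section TensorSquareCone

variable {X : Type*} [TopologicalSpace X] [CompactSpace X]

theorem isClosed_tensorSquareCone : IsClosed (tensorSquareCone X : Set C(X × X, ℝ)) :=
  Subsemiring.isClosed_topologicalClosure _

theorem tensorSquare_mem_cone (k : C(X, ℝ)) : tensorSquare X k ∈ tensorSquareCone X :=
  Subsemiring.le_topologicalClosure _ (AddSubmonoid.subset_closure ⟨k, rfl⟩)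

theorem smul_mem_tensorSquareCone {r : ℝ} (hr : 0 ≤ r) {k : C(X × X, ℝ)}
    (hk : k ∈ tensorSquareCone X) : r • k ∈ tensorSquareCone X := by
  have h : r • k = tensorSquare X (.const X √r) * k := by
    ext z
    simp [tensorSquare, Real.mul_self_sqrt hr]
  exact h ▸ mul_mem (tensorSquare_mem_cone _) hk

theorem exp_mem_tensorSquareCone {k : C(X × X, ℝ)} (hk : k ∈ tensorSquareCone X) :
    NormedSpace.exp k ∈ tensorSquareCone X := by
  refine isClosed_tensorSquareCone.mem_of_tendsto
    (NormedSpace.exp_series_hasSum_exp' (𝕂 := ℝ) k) (.of_forall fun s => ?_)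
  exact sum_mem fun n _ => smul_mem_tensorSquareCone (by positivity) (pow_mem hk n)

theorem exp_sub_exp_neg_mem_tensorSquareCone {k : C(X × X, ℝ)} (hk : k ∈ tensorSquareCone X) :
    NormedSpace.exp k - NormedSpace.exp (-k) ∈ tensorSquareCone X := by
  refine isClosed_tensorSquareCone.mem_of_tendsto
    ((NormedSpace.exp_series_hasSum_exp' (𝕂 := ℝ) k).sub
      (NormedSpace.exp_series_hasSum_exp' (𝕂 := ℝ) (-k))) (.of_forall fun s => ?_)
  refine sum_mem fun n _ => ?_
  rw [← smul_sub]
  refine smul_mem_tensorSquareCone (by positivity) ?_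
  rcases n.even_or_odd with hn | hn
  · simp [hn.neg_pow]
  · rw [hn.neg_pow, sub_neg_eq_add]
    exact add_mem (pow_mem hk n) (pow_mem hk n)

theorem continuous_integral_continuousMap [MeasurableSpace X] [BorelSpace X]
    [SecondCountableTopology X] (μ : Measure X) [IsFiniteMeasure μ] :
    Continuous fun k : C(X, ℝ) => ∫ x, k x ∂μ := by
  refine (continuous_integral.comp
    (ContinuousMap.toLp (E := ℝ) 1 μ ℝ).continuous).congr fun k => ?_
  exact integral_congr_ae (ContinuousMap.coeFn_toLp μ k)

theorem ContinuousMap.integrable_of_compactSpace [MeasurableSpace X] [OpensMeasurableSpace X]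
    {μ : Measure X} [IsFiniteMeasure μ] (k : C(X, ℝ)) : Integrable k μ :=
  k.continuous.integrable_of_hasCompactSupport (HasCompactSupport.of_compactSpace k)

theorem integral_nonneg_of_mem_tensorSquareCone [MeasurableSpace X] [BorelSpace X]
    [SecondCountableTopology X] (μ : Measure X) [IsFiniteMeasure μ] {k : C(X × X, ℝ)}
    (hk : k ∈ tensorSquareCone X) : 0 ≤ ∫ z, k z ∂μ.prod μ := by
  refine closure_minimal (t := {k : C(X × X, ℝ) | 0 ≤ ∫ z, k z ∂μ.prod μ}) (fun k hk => ?_)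
    (isClosed_le continuous_const (continuous_integral_continuousMap _)) hk
  induction hk using AddSubmonoid.closure_induction with
  | mem k hk =>
    obtain ⟨l, rfl⟩ := hk
    change 0 ≤ ∫ z : X × X, l z.1 * l z.2 ∂μ.prod μ
    rw [integral_prod_mul]
    exact mul_self_nonneg _
  | zero => simp
  | add k l _ _ hk hl =>
    simp only [Set.mem_ofPred_eq, ContinuousMap.add_apply] at *
    rw [integral_add k.integrable_of_compactSpace l.integrable_of_compactSpace]
    exact add_nonneg hk hl

end TensorSquareCone

section Ginibre

variable (G : Type*) [AddCommGroup G]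

/-- The map `(a, b) ↦ (a - b, a + b)`. -/
def subAddHom : G × G →+ G × G where
  toFun z := (z.1 - z.2, z.1 + z.2)
  map_zero' := by simp
  map_add' z w := by ext <;> simp <;> abel

theorem subAddHom_surjective [DivisibleBy G ℤ] : Function.Surjective (subAddHom G) := by
  rintro ⟨p, q⟩
  obtain ⟨h, hh⟩ : ∃ h : G, (2 : ℤ) • h = q - p :=
    ⟨DivisibleBy.div (q - p) 2, DivisibleBy.div_cancel _ (by norm_num)⟩
  refine ⟨(p + h, h), ?_⟩
  have : p + h + h = q := by rw [add_assoc, ← two_zsmul, hh]; abel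
  simp [subAddHom, this]

variable [TopologicalSpace G] [IsTopologicalAddGroup G]

theorem continuous_subAddHom : Continuous (subAddHom G) := by
  change Continuous fun z : G × G => (z.1 - z.2, z.1 + z.2)
  fun_prop

variable {G}

/-- The pullback of `k` along `(a, b) ↦ a - b`. -/
def pullSub : C(G, ℝ) →+* C(G × G, ℝ) where
  toFun k := k.comp ⟨fun z => z.1 - z.2, by fun_prop⟩
  map_zero' := rfl
  map_one' := rfl
  map_add' _ _ := rfl
  map_mul' _ _ := rfl

/-- The pullback of `k` along `(a, b) ↦ a + b`. -/
def pullAdd : C(G, ℝ) →+* C(G × G, ℝ) where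
  toFun k := k.comp ⟨fun z => z.1 + z.2, by fun_prop⟩
  map_zero' := rfl
  map_one' := rfl
  map_add' _ _ := rfl
  map_mul' _ _ := rfl

@[simp]
theorem pullSub_apply (k : C(G, ℝ)) (z : G × G) : pullSub k z = k (z.1 - z.2) := rfl

@[simp]
theorem pullAdd_apply (k : C(G, ℝ)) (z : G × G) : pullAdd k z = k (z.1 + z.2) := rfl

variable [CompactSpace G]

variable (G) in
/-- The functions `k` for which `k(a - b) ± k(a + b)` are limits of sums of products `l(a) l(b)`. -/
def ginibreCone : Subsemiring C(G, ℝ) where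
  carrier := {k | pullSub k + pullAdd k ∈ tensorSquareCone G ∧
    pullSub k - pullAdd k ∈ tensorSquareCone G}
  zero_mem' := by simp
  one_mem' := by simpa using add_mem (one_mem (tensorSquareCone G)) (one_mem _)
  add_mem' {k l} hk hl := by
    refine ⟨?_, ?_⟩
    · convert! add_mem hk.1 hl.1 using 1
      simp only [map_add]; ring
    · convert! add_mem hk.2 hl.2 using 1
      simp only [map_add]; ring
  mul_mem' {k l} hk hl := by
    have half : (0 : ℝ) ≤ 1 / 2 := by norm_num
    refine ⟨?_, ?_⟩
    · convert! smul_mem_tensorSquareCone half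
        (add_mem (mul_mem hk.1 hl.1) (mul_mem hk.2 hl.2)) using 1
      ext z; simp; ring
    · convert! smul_mem_tensorSquareCone half
        (add_mem (mul_mem hk.1 hl.2) (mul_mem hk.2 hl.1)) using 1
      ext z; simp; ring

theorem smul_mem_ginibreCone {r : ℝ} (hr : 0 ≤ r) {k : C(G, ℝ)} (hk : k ∈ ginibreCone G) :
    r • k ∈ ginibreCone G := by
  refine ⟨?_, ?_⟩
  · convert! smul_mem_tensorSquareCone hr hk.1 using 1
    ext z; simp
  · convert! smul_mem_tensorSquareCone hr hk.2 using 1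
    ext z; simp; ring

theorem mem_ginibreCone_of_addition_formulas (c s : C(G, ℝ))
    (hadd : ∀ a b, c (a + b) = c a * c b - s a * s b)
    (hsub : ∀ a b, c (a - b) = c a * c b + s a * s b) : c ∈ ginibreCone G := by
  refine ⟨?_, ?_⟩
  · convert! add_mem (tensorSquare_mem_cone c) (tensorSquare_mem_cone c) using 1
    ext z; simp [tensorSquare, hadd, hsub]
  · convert! add_mem (tensorSquare_mem_cone s) (tensorSquare_mem_cone s) using 1
    ext z; simp [tensorSquare, hadd, hsub]

variable [SecondCountableTopology G] [DivisibleBy G ℤ] [MeasurableSpace G]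
  [BorelSpace G]

/-- Ginibre's inequality, integrated in the inverse temperature: for `f` and `K` in the Ginibre
cone the Gibbs average of `f` with weight `exp (t K)` is nondecreasing in `t`. -/
theorem integral_mul_exp_mul_le (μ : Measure G) [μ.IsAddHaarMeasure] {f K : C(G, ℝ)}
    (hf : f ∈ ginibreCone G) (hK : K ∈ ginibreCone G) {t u : ℝ} (ht : 0 ≤ t) (htu : t ≤ u) :
    (∫ x, f x * Real.exp (t * K x) ∂μ) * ∫ x, Real.exp (u * K x) ∂μ ≤
      (∫ x, f x * Real.exp (u * K x) ∂μ) * ∫ x, Real.exp (t * K x) ∂μ := by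
  let D : G × G → ℝ := fun z => (f z.1 - f z.2) *
    (Real.exp (u * K z.1) * Real.exp (t * K z.2) - Real.exp (t * K z.1) * Real.exp (u * K z.2))
  have hD : 0 ≤ ∫ z, D z ∂μ.prod μ := by
    have hpos := integral_nonneg_of_mem_tensorSquareCone μ
      (mul_mem (mul_mem hf.2 (exp_mem_tensorSquareCone
        (smul_mem_tensorSquareCone (r := (t + u) / 2) (by linarith) hK.1)))
        (exp_sub_exp_neg_mem_tensorSquareCone
          (smul_mem_tensorSquareCone (r := (u - t) / 2) (by linarith) hK.2)))
    have hmp : MeasurePreserving (subAddHom G) (μ.prod μ) (μ.prod μ) :=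
      (subAddHom G).measurePreserving (continuous_subAddHom G) (subAddHom_surjective G) rfl
    have hDc : Continuous D := by fun_prop
    rw [← hmp.map_eq, integral_map hmp.aemeasurable hDc.aestronglyMeasurable]
    refine hpos.trans_eq (integral_congr_ae (.of_forall fun z => ?_))
    simp only [NormedSpace.exp_continuousMap_eq, ContinuousMap.mul_apply,
      ContinuousMap.sub_apply, ContinuousMap.add_apply, ContinuousMap.coe_mk,
      ContinuousMap.smul_apply, ContinuousMap.neg_apply, Function.comp_apply,
      ← Real.exp_eq_exp_ℝ, pullSub_apply, pullAdd_apply, D, subAddHom, AddMonoidHom.coe_mk,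
      ZeroHom.coe_mk, smul_eq_mul]
    rw [mul_assoc, mul_sub, ← Real.exp_add, ← Real.exp_add, ← Real.exp_add, ← Real.exp_add]
    ring_nf
  have hint : ∀ F : G × G → ℝ, Continuous F → Integrable F (μ.prod μ) := fun F hF =>
    ContinuousMap.integrable_of_compactSpace ⟨F, hF⟩
  have hexpand : ∫ z, D z ∂μ.prod μ =
      2 * ((∫ x, f x * Real.exp (u * K x) ∂μ) * ∫ x, Real.exp (t * K x) ∂μ) -
      2 * ((∫ x, f x * Real.exp (t * K x) ∂μ) * ∫ x, Real.exp (u * K x) ∂μ) := by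
    have hDeq : D = fun z =>
        ((f z.1 * Real.exp (u * K z.1)) * Real.exp (t * K z.2) +
          Real.exp (t * K z.1) * (f z.2 * Real.exp (u * K z.2))) -
        ((f z.1 * Real.exp (t * K z.1)) * Real.exp (u * K z.2) +
          Real.exp (u * K z.1) * (f z.2 * Real.exp (t * K z.2))) := by
      funext z
      simp only [D]
      ring
    rw [hDeq, integral_sub (hint _ (by fun_prop)) (hint _ (by fun_prop)),
      integral_add (hint _ (by fun_prop)) (hint _ (by fun_prop)),
      integral_add (hint _ (by fun_prop)) (hint _ (by fun_prop)),
      integral_prod_mul (fun x => f x * Real.exp (u * K x)) (fun x => Real.exp (t * K x)),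
      integral_prod_mul (fun x => f x * Real.exp (t * K x)) (fun x => Real.exp (u * K x)),
      integral_prod_mul (fun x => Real.exp (u * K x)) (fun x => f x * Real.exp (t * K x)),
      integral_prod_mul (fun x => Real.exp (t * K x)) (fun x => f x * Real.exp (u * K x))]
    ring
  linarith

end Ginibre

section Torus

variable {Λ : Type*}

/-- The cosine of the coordinate `x`, on the torus of configurations. -/
noncomputable def torusCos (x : Λ) : C(Λ → AddCircle (2 * π), ℝ) :=
  ⟨fun φ => Real.Angle.cos (φ x), Real.Angle.continuous_cos.comp (continuous_apply x)⟩

/-- The sine of the coordinate `x`, on the torus of configurations. -/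
noncomputable def torusSin (x : Λ) : C(Λ → AddCircle (2 * π), ℝ) :=
  ⟨fun φ => Real.Angle.sin (φ x), Real.Angle.continuous_sin.comp (continuous_apply x)⟩

theorem torusCos_add (x : Λ) (φ ψ : Λ → AddCircle (2 * π)) :
    torusCos x (φ + ψ) = torusCos x φ * torusCos x ψ - torusSin x φ * torusSin x ψ :=
  Real.Angle.cos_add _ _

theorem torusSin_add (x : Λ) (φ ψ : Λ → AddCircle (2 * π)) :
    torusSin x (φ + ψ) = torusSin x φ * torusCos x ψ + torusCos x φ * torusSin x ψ :=
  Real.Angle.sin_add _ _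

theorem torusCos_neg (x : Λ) (φ : Λ → AddCircle (2 * π)) : torusCos x (-φ) = torusCos x φ :=
  Real.Angle.cos_neg _

theorem torusSin_neg (x : Λ) (φ : Λ → AddCircle (2 * π)) : torusSin x (-φ) = -torusSin x φ :=
  Real.Angle.sin_neg _

theorem prod_torusCos_coe (B : Finset Λ) (φ : Λ → ℝ) :
    (∏ x ∈ B, torusCos x) (fun x => (φ x : AddCircle (2 * π))) = sigma1 B φ := by
  rw [ContinuousMap.prod_apply]
  rfl

/-- The function `-H` on the torus of configurations. -/
noncomputable def torusInteraction [Fintype Λ] (J1 J2 : Finset Λ → ℝ) :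
    C(Λ → AddCircle (2 * π), ℝ) :=
  ∑ A : Finset Λ, (J1 A • ∏ x ∈ A, torusCos x + J2 A • ∏ x ∈ A, torusSin x)

theorem torusInteraction_coe [Fintype Λ] (J1 J2 : Finset Λ → ℝ) (φ : Λ → ℝ) :
    torusInteraction J1 J2 (fun x => (φ x : AddCircle (2 * π))) = -xyHam J1 J2 φ := by
  have hc (x : Λ) : torusCos x (fun x => (φ x : AddCircle (2 * π))) = Real.cos (φ x) := rfl
  have hs (x : Λ) : torusSin x (fun x => (φ x : AddCircle (2 * π))) = Real.sin (φ x) := rfl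
  simp [torusInteraction, xyHam, ContinuousMap.sum_apply, hc, hs]

variable [Fact (0 < 2 * π)]

theorem torusCos_mem (x : Λ) : torusCos x ∈ ginibreCone (Λ → AddCircle (2 * π)) :=
  mem_ginibreCone_of_addition_formulas _ (torusSin x) (torusCos_add x) fun φ ψ => by
    rw [sub_eq_add_neg, torusCos_add, torusCos_neg, torusSin_neg]
    ring

/-- The functions `cos (φ x - φ y)` and `cos (φ x + φ y)` lie in the Ginibre cone. -/
theorem torusCos_mul_add_sub_mem (x y : Λ) :
    torusCos x * torusCos y + torusSin x * torusSin y ∈ ginibreCone (Λ → AddCircle (2 * π)) ∧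
    torusCos x * torusCos y - torusSin x * torusSin y ∈ ginibreCone (Λ → AddCircle (2 * π)) := by
  refine ⟨mem_ginibreCone_of_addition_formulas _
      (torusSin x * torusCos y - torusCos x * torusSin y) ?_ ?_,
    mem_ginibreCone_of_addition_formulas _
      (torusSin x * torusCos y + torusCos x * torusSin y) ?_ ?_⟩ <;>
  · intro φ ψ
    simp only [sub_eq_add_neg φ ψ, ContinuousMap.add_apply, ContinuousMap.sub_apply,
      ContinuousMap.mul_apply, torusCos_add, torusSin_add, torusCos_neg, torusSin_neg]
    ring

theorem prod_torusCos_add_sub_mem (A : Finset Λ) (hA : Even A.card) :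
    ∏ x ∈ A, torusCos x + ∏ x ∈ A, torusSin x ∈ ginibreCone (Λ → AddCircle (2 * π)) ∧
    ∏ x ∈ A, torusCos x - ∏ x ∈ A, torusSin x ∈ ginibreCone (Λ → AddCircle (2 * π)) := by
  classical
  induction A using Finset.strongInduction with
  | H A ih =>
  rcases A.eq_empty_or_nonempty with rfl | ⟨x, hx⟩
  · simpa using add_mem (one_mem (ginibreCone (Λ → AddCircle (2 * π)))) (one_mem _)
  have hcx := Finset.card_erase_add_one hx
  obtain ⟨y, hy⟩ : (A.erase x).Nonempty := by
    rw [← Finset.card_pos]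
    by_contra h
    rw [show A.card = 1 by omega] at hA
    exact absurd hA (by decide)
  have hcy := Finset.card_erase_add_one hy
  obtain ⟨hp, hm⟩ := ih ((A.erase x).erase y)
    ((Finset.erase_ssubset hy).trans (Finset.erase_ssubset hx)) (by grind)
  obtain ⟨hp', hm'⟩ := torusCos_mul_add_sub_mem x y
  have half : (0 : ℝ) ≤ 1 / 2 := by norm_num
  rw [← Finset.mul_prod_erase A torusCos hx, ← Finset.mul_prod_erase A torusSin hx,
    ← Finset.mul_prod_erase _ torusCos hy, ← Finset.mul_prod_erase _ torusSin hy]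
  refine ⟨?_, ?_⟩
  · convert! smul_mem_ginibreCone half (add_mem (mul_mem hp' hp) (mul_mem hm' hm)) using 1
    ext φ
    simp only [ContinuousMap.add_apply, ContinuousMap.sub_apply, ContinuousMap.mul_apply,
      ContinuousMap.smul_apply, smul_eq_mul]
    ring
  · convert! smul_mem_ginibreCone half (add_mem (mul_mem hp' hm) (mul_mem hm' hp)) using 1
    ext φ
    simp only [ContinuousMap.add_apply, ContinuousMap.sub_apply, ContinuousMap.mul_apply,
      ContinuousMap.smul_apply, smul_eq_mul]
    ring

theorem smul_prod_torusCos_add_mem (A : Finset Λ) {a b : ℝ} (hab : |b| ≤ a)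
    (hodd : Odd A.card → b = 0) :
    a • ∏ x ∈ A, torusCos x + b • ∏ x ∈ A, torusSin x ∈
      ginibreCone (Λ → AddCircle (2 * π)) := by
  obtain ⟨hl, hr⟩ := abs_le.mp hab
  rcases A.card.even_or_odd with hA | hA
  · obtain ⟨hp, hm⟩ := prod_torusCos_add_sub_mem A hA
    convert! add_mem
      (smul_mem_ginibreCone (r := (a + b) / 2) (by linarith) hp)
      (smul_mem_ginibreCone (r := (a - b) / 2) (by linarith) hm) using 1
    module
  · rw [hodd hA] at hab ⊢
    simpa using smul_mem_ginibreCone ((abs_nonneg _).trans hab)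
      (prod_mem fun x (_ : x ∈ A) => torusCos_mem x)

variable [Fintype Λ]

theorem measurePreserving_xyBox :
    MeasurePreserving (fun (φ : Λ → ℝ) x => (φ x : AddCircle (2 * π)))
      (volume.restrict (xyBox Λ)) volume := by
  rw [xyBox, volume_pi, Measure.restrict_pi_pi]
  refine measurePreserving_pi _ _ fun _ => ?_
  simpa only [zero_add, restrict_Ioc_eq_restrict_Icc] using
    AddCircle.measurePreserving_mk (2 * π) 0

theorem setIntegral_xyBox {F : (Λ → AddCircle (2 * π)) → ℝ} (hF : Continuous F) :
    ∫ φ in xyBox Λ, F (fun x => (φ x : AddCircle (2 * π))) = ∫ φ, F φ := by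
  rw [← measurePreserving_xyBox.map_eq,
    integral_map measurePreserving_xyBox.aemeasurable hF.aestronglyMeasurable]

theorem xyGibbs_sigma1_eq (J1 J2 : Finset Λ → ℝ) (β : ℝ) (B : Finset Λ) :
    xyGibbs J1 J2 β (sigma1 B) =
      (∫ φ, (∏ x ∈ B, torusCos x) φ * Real.exp (β * torusInteraction J1 J2 φ)) /
        ∫ φ, Real.exp (β * torusInteraction J1 J2 φ) := by
  rw [← setIntegral_xyBox (by fun_prop), ← setIntegral_xyBox (by fun_prop)]
  simp_rw [torusInteraction_coe, prod_torusCos_coe, mul_neg, xyGibbs, neg_mul]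

theorem integral_exp_torus_pos (k : C(Λ → AddCircle (2 * π), ℝ)) (β : ℝ) :
    0 < ∫ φ, Real.exp (β * k φ) :=
  integral_exp_pos (ContinuousMap.integrable_of_compactSpace
    ⟨fun φ => Real.exp (β * k φ), by fun_prop⟩)

end Torus

/-- Monotonicity of classical XY correlations in the inverse temperature: if `J¹_A ≥ |J²_A|`
for all `A` and `J²_A = 0` whenever `|A|` is odd, then `⟨σ¹_B⟩` is nondecreasing in `β`. -/
theorem classical_xy_monotone_beta {Λ : Type*} [Fintype Λ] (J1 J2 : Finset Λ → ℝ)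
    (hJ : ∀ A : Finset Λ, |J2 A| ≤ J1 A)
    (hodd : ∀ A : Finset Λ, Odd A.card → J2 A = 0)
    (B : Finset Λ) (β β' : ℝ) (hβ : 0 < β) (hββ' : β ≤ β') :
    xyGibbs J1 J2 β (sigma1 B) ≤ xyGibbs J1 J2 β' (sigma1 B) := by

  have : Fact (0 < 2 * π) := ⟨Real.two_pi_pos⟩
  rw [xyGibbs_sigma1_eq, xyGibbs_sigma1_eq,
    div_le_div_iff₀ (integral_exp_torus_pos _ _) (integral_exp_torus_pos _ _)]
  exact integral_mul_exp_mul_le _ (prod_mem fun x _ => torusCos_mem x)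
    (sum_mem fun A _ => smul_prod_torusCos_add_mem A (hJ A) (hodd A)) hβ.le hββ'
end

section
/- (Griffiths second inequality.) Assume J_A ≥ 0 for all A ⊆ Λ. Then for all B, C ⊆ Λ and every β > 0 the Ising Gibbs expectation satisfies ⟨s_B s_C⟩ ≥ ⟨s_B⟩⟨s_C⟩. -/
open MeasureTheory Real

/-- The ±1 value of an Ising spin encoded by a Boolean. -/
def isingSpin (b : Bool) : ℝ := if b then 1 else -1

/-- Ising Hamiltonian with many-body couplings: `H(s) = −Σ_{A⊆Λ} J_A ∏_{x∈A} s_x`. -/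
noncomputable def isingHam {Λ : Type*} [Fintype Λ] (J : Finset Λ → ℝ) (s : Λ → Bool) : ℝ :=
  - ∑ A : Finset Λ, J A * ∏ x ∈ A, isingSpin (s x)

/-- Ising Gibbs expectation at inverse temperature `β`:
`⟨f⟩ = Z⁻¹ Σ_s f(s) e^{−βH(s)}`. -/
noncomputable def isingGibbs {Λ : Type*} [Fintype Λ] [DecidableEq Λ] (J : Finset Λ → ℝ)
    (β : ℝ) (f : (Λ → Bool) → ℝ) : ℝ :=
  (∑ s : Λ → Bool, f s * Real.exp (-β * isingHam J s)) /
  (∑ s : Λ → Bool, Real.exp (-β * isingHam J s))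

/-- `s_B = ∏_{x∈B} s_x`. -/
def isingSigma {Λ : Type*} (B : Finset Λ) (s : Λ → Bool) : ℝ :=
  ∏ x ∈ B, isingSpin (s x)

theorem isingSpin_mul_self (b : Bool) : isingSpin b * isingSpin b = 1 := by
  cases b <;> simp [isingSpin]

theorem isingSigma_mul_self {Λ : Type*} (B : Finset Λ) (s : Λ → Bool) :
    isingSigma B s * isingSigma B s = 1 := by
  simp [isingSigma, ← Finset.prod_mul_distrib, isingSpin_mul_self]

theorem isingSigma_eq_one_or {Λ : Type*} (B : Finset Λ) (s : Λ → Bool) :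
    isingSigma B s = 1 ∨ isingSigma B s = -1 :=
  mul_self_eq_one_iff.mp (isingSigma_mul_self B s)

theorem isingSigma_beq {Λ : Type*} (B : Finset Λ) (s u : Λ → Bool) :
    isingSigma B (fun x => s x == u x) = isingSigma B s * isingSigma B u := by
  simp only [isingSigma, ← Finset.prod_mul_distrib]
  refine Finset.prod_congr rfl fun x _ => ?_
  cases s x <;> cases u x <;> simp [isingSpin]

theorem isingSigma_mul {Λ : Type*} [DecidableEq Λ] (A B : Finset Λ) (s : Λ → Bool) :
    isingSigma A s * isingSigma B s = isingSigma (symmDiff A B) s := by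
  have hA : isingSigma A s = isingSigma (A \ B) s * isingSigma (A ∩ B) s := by
    rw [isingSigma, ← Finset.prod_inter_mul_prod_sdiff A B, mul_comm]
    rfl
  have hB : isingSigma B s = isingSigma (B \ A) s * isingSigma (A ∩ B) s := by
    rw [isingSigma, ← Finset.prod_inter_mul_prod_sdiff B A, mul_comm, Finset.inter_comm B A]
    rfl
  have hAB : isingSigma (symmDiff A B) s = isingSigma (A \ B) s * isingSigma (B \ A) s :=
    Finset.prod_union disjoint_sdiff_sdiff
  rw [hA, hB, hAB]
  linear_combination isingSigma (A \ B) s * isingSigma (B \ A) s * isingSigma_mul_self (A ∩ B) s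

theorem sum_isingSigma_nonneg {Λ : Type*} [Fintype Λ] [DecidableEq Λ] (B : Finset Λ) :
    0 ≤ ∑ s : Λ → Bool, isingSigma B s := by
  have h : ∑ s : Λ → Bool, isingSigma B s =
      ∏ x : Λ, ∑ b : Bool, if x ∈ B then isingSpin b else 1 := by
    rw [Fintype.prod_sum]
    simp [isingSigma, Finset.prod_ite_mem]
  rw [h]
  refine Finset.prod_nonneg fun x _ => ?_
  by_cases hx : x ∈ B <;> simp [hx, isingSpin]

theorem exp_mul_isingSigma {Λ : Type*} (k : ℝ) (A : Finset Λ) (s : Λ → Bool) :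
    Real.exp (k * isingSigma A s) = Real.cosh k + Real.sinh k * isingSigma A s := by
  rcases isingSigma_eq_one_or A s with h | h <;> rw [h]
  · simp [Real.cosh_add_sinh]
  · rw [mul_neg_one, mul_neg_one, ← sub_eq_add_neg, Real.cosh_sub_sinh]

/-- Griffiths' first inequality, in unnormalised form. -/
theorem sum_isingSigma_mul_exp_nonneg {Λ : Type*} [Fintype Λ] [DecidableEq Λ]
    (K : Finset Λ → ℝ) (hK : ∀ A, 0 ≤ K A) (S : Finset (Finset Λ)) (B : Finset Λ) :
    0 ≤ ∑ s : Λ → Bool, isingSigma B s * Real.exp (∑ A ∈ S, K A * isingSigma A s) := by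
  induction S using Finset.induction_on generalizing B with
  | empty => simpa using sum_isingSigma_nonneg B
  | insert A S hA ih =>
    have h : ∑ s : Λ → Bool, isingSigma B s *
          Real.exp (∑ A' ∈ insert A S, K A' * isingSigma A' s) =
        Real.cosh (K A) *
          ∑ s : Λ → Bool, isingSigma B s * Real.exp (∑ A' ∈ S, K A' * isingSigma A' s) +
        Real.sinh (K A) * ∑ s : Λ → Bool,
          isingSigma (symmDiff B A) s * Real.exp (∑ A' ∈ S, K A' * isingSigma A' s) := by
      rw [Finset.mul_sum, Finset.mul_sum, ← Finset.sum_add_distrib]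
      refine Finset.sum_congr rfl fun s _ => ?_
      rw [Finset.sum_insert hA, Real.exp_add, exp_mul_isingSigma, ← isingSigma_mul]
      ring
    rw [h]
    exact add_nonneg (mul_nonneg (Real.cosh_pos _).le (ih B))
      (mul_nonneg (Real.sinh_nonneg_iff.mpr (hK A)) (ih _))

/-- Site-wise multiplication by the spin configuration `s`, as a permutation. -/
def isingFlip {Λ : Type*} (s : Λ → Bool) : Equiv.Perm (Λ → Bool) :=
  Function.Involutive.toPerm (fun u x => s x == u x) fun u => by
    funext x
    cases hs : s x <;> simp [hs]

/-- Griffiths' second inequality before dividing by the partition function: after the change of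
variables `t = s * u` in the duplicated system, each `u` contributes a first-inequality sum. -/
theorem sum_mul_sum_le_of_ferromagnetic {Λ : Type*} [Fintype Λ] [DecidableEq Λ]
    (K : Finset Λ → ℝ) (hK : ∀ A, 0 ≤ K A) (w : (Λ → Bool) → ℝ)
    (hw : ∀ s, w s = Real.exp (∑ A, K A * isingSigma A s)) (B C : Finset Λ) :
    (∑ s, isingSigma B s * w s) * (∑ s, isingSigma C s * w s) ≤
      (∑ s, isingSigma B s * isingSigma C s * w s) * ∑ s, w s := by
  rw [← sub_nonneg]
  have h : (∑ s, isingSigma B s * isingSigma C s * w s) * ∑ s, w s -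
        (∑ s, isingSigma B s * w s) * (∑ s, isingSigma C s * w s) =
      ∑ u : Λ → Bool, (1 - isingSigma C u) * ∑ s : Λ → Bool, isingSigma (symmDiff B C) s *
        Real.exp (∑ A, (K A * (1 + isingSigma A u)) * isingSigma A s) := by
    rw [Finset.sum_mul_sum, Finset.sum_mul_sum]
    simp only [← Finset.sum_sub_distrib]
    conv_rhs =>
      simp only [Finset.mul_sum]
      rw [Finset.sum_comm]
    refine Finset.sum_congr rfl fun s _ => ?_
    rw [← Equiv.sum_comp (isingFlip s)]
    refine Finset.sum_congr rfl fun u _ => ?_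
    have hf (A : Finset Λ) : isingSigma A (isingFlip s u) = isingSigma A s * isingSigma A u :=
      isingSigma_beq A s u
    have he : Real.exp (∑ A, (K A * (1 + isingSigma A u)) * isingSigma A s) =
        w s * w (isingFlip s u) := by
      rw [hw, hw, ← Real.exp_add, ← Finset.sum_add_distrib]
      refine congrArg Real.exp (Finset.sum_congr rfl fun A _ => ?_)
      rw [hf]
      ring
    rw [he, ← isingSigma_mul, hf]
    ring
  rw [h]
  refine Finset.sum_nonneg fun u _ => mul_nonneg ?_
    (sum_isingSigma_mul_exp_nonneg _ (fun A => mul_nonneg (hK A) ?_) _ _)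
  · rcases isingSigma_eq_one_or C u with h | h <;> rw [h] <;> norm_num
  · rcases isingSigma_eq_one_or A u with h | h <;> rw [h] <;> norm_num

/-- Griffiths' second inequality: `⟨s_B s_C⟩ ≥ ⟨s_B⟩⟨s_C⟩` for ferromagnetic couplings. -/
theorem ising_griffiths_second {Λ : Type*} [Fintype Λ] [DecidableEq Λ]
    (J : Finset Λ → ℝ) (hJ : ∀ A : Finset Λ, 0 ≤ J A)
    (B C : Finset Λ) (β : ℝ) (hβ : 0 < β) :
    isingGibbs J β (isingSigma B) * isingGibbs J β (isingSigma C) ≤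
      isingGibbs J β (fun s => isingSigma B s * isingSigma C s) := by
  have hZ : 0 < ∑ s : Λ → Bool, Real.exp (-β * isingHam J s) :=
    Finset.sum_pos (fun s _ => Real.exp_pos _) Finset.univ_nonempty
  have key := sum_mul_sum_le_of_ferromagnetic (fun A => β * J A)
    (fun A => mul_nonneg hβ.le (hJ A)) (fun s => Real.exp (-β * isingHam J s))
    (fun s => by simp [isingHam, isingSigma, Finset.mul_sum, mul_assoc]) B C
  simp only [isingGibbs]
  rw [div_mul_div_comm, div_le_div_iff₀ (mul_pos hZ hZ) hZ, ← mul_assoc]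
  exact mul_le_mul_of_nonneg_right key hZ.le
end
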